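/- arXiv:1403.2634 — 2 statements merged into one kernel-verified Lean document; each statement's English description precedes it below -/
import Mathlib

section
/- If Γ ≤ Diff^ω₊(I) is a solvable subgroup, then h_strict(Γ) = 1; equivalently, Γ does not possess a strict tower of cardinality two. -/
open Set

namespace HeightHomeo

/-- The group of orientation-preserving homeomorphisms of a linearly ordered space,
modeled as order-automorphisms (for `I = [0,1]` these are exactly the
orientation-preserving homeomorphisms). -/
instance ordIsoGroup {α : Type*} [Preorder α] : Group (α ≃o α) where
  mul f g := g.trans f
  one := OrderIso.refl α
  inv := OrderIso.symm
  mul_assoc _ _ _ := rfl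
  one_mul _ := rfl
  mul_one _ := rfl
  inv_mul_cancel f := by ext x; exact f.symm_apply_apply x

/-- `Homeo₊(I)`: the group of orientation-preserving homeomorphisms of the closed
unit interval `I = [0,1]`. -/
abbrev HomeoI := unitInterval ≃o unitInterval

/-- The order-convex hull of a set of points of the unit interval. -/
def ordHull (S : Set unitInterval) : Set unitInterval :=
  {y | ∃ a ∈ S, ∃ b ∈ S, a ≤ y ∧ y ≤ b}

/-- `A` is an orbital of the homeomorphism `g`: the convex hull of the orbit of some
point of `I` under the cyclic subgroup `⟨g⟩`, provided it contains more than one point. -/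
def IsOrbitalOf (g : HomeoI) (A : Set unitInterval) : Prop :=
  ∃ x : unitInterval,
    A = ordHull (Set.range fun n : ℤ => (g ^ n) x) ∧ A.Nontrivial

/-- A tower of a subgroup `Γ ≤ Homeo₊(I)`: a set `T` of signed orbitals `(A, g)`
(with `g ∈ Γ` and `A` an orbital of `g`) whose orbitals form a chain under inclusion,
and containing exactly one signed orbital for each of the occurring orbitals. -/
def IsTower (Γ : Subgroup HomeoI) (T : Set (Set unitInterval × HomeoI)) : Prop :=
  (∀ p ∈ T, p.2 ∈ Γ ∧ IsOrbitalOf p.2 p.1) ∧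
  (∀ p ∈ T, ∀ q ∈ T, p.1 ⊆ q.1 ∨ q.1 ⊆ p.1) ∧
  (∀ p ∈ T, ∀ q ∈ T, p.1 = q.1 → p = q)

/-- The left endpoint of a set of points of the unit interval, as a real number. -/
noncomputable def leftEnd (A : Set unitInterval) : ℝ :=
  sInf ((fun x : unitInterval => (x : ℝ)) '' A)

/-- The right endpoint of a set of points of the unit interval, as a real number. -/
noncomputable def rightEnd (A : Set unitInterval) : ℝ :=
  sSup ((fun x : unitInterval => (x : ℝ)) '' A)

/-- Two intervals share an end if they have a common left endpoint or a common right
endpoint. -/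
def ShareEnd (A B : Set unitInterval) : Prop :=
  leftEnd A = leftEnd B ∨ rightEnd A = rightEnd B

/-- A tower is strict if no two distinct orbitals occurring in it share an end. -/
def IsStrictTower (Γ : Subgroup HomeoI) (T : Set (Set unitInterval × HomeoI)) : Prop :=
  IsTower Γ T ∧ ∀ p ∈ T, ∀ q ∈ T, p.1 ≠ q.1 → ¬ ShareEnd p.1 q.1

/-- The set of orbitals occurring in a tower. -/
def towerOrbitals (T : Set (Set unitInterval × HomeoI)) : Set (Set unitInterval) :=
  Prod.fst '' T

/-- The height `h(Γ)` of a subgroup of `Homeo₊(I)`: the supremum (in `ℕ∞`) of the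
cardinalities of the sets of orbitals of its towers. -/
noncomputable def height (Γ : Subgroup HomeoI) : ℕ∞ :=
  ⨆ T ∈ {T | IsTower Γ T}, (towerOrbitals T).encard

/-- The strict height `h_strict(Γ)` of a subgroup of `Homeo₊(I)`: the supremum (in
`ℕ∞`) of the cardinalities of the sets of orbitals of its strict towers. -/
noncomputable def strictHeight (Γ : Subgroup HomeoI) : ℕ∞ :=
  ⨆ T ∈ {T | IsStrictTower Γ T}, (towerOrbitals T).encard

/-- `f ∈ Diff^ω₊(I)`: `f` extends to a real-analytic map on a neighborhood of `[0,1]`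
(being an order-automorphism of `[0,1]`, `f` is automatically strictly increasing and
fixes `0` and `1`). -/
def IsAnalytic (f : HomeoI) : Prop :=
  ∃ F : ℝ → ℝ, (∀ x ∈ Set.Icc (0 : ℝ) 1, AnalyticAt ℝ F x) ∧
    ∀ x : unitInterval, F x = (f x : ℝ)

open Filter Topology

/-- Bounded distortion: if `F` is analytic with positive derivative at `p`, then along an orbit
`y` close to `p`, the intervals `[w n, y n] ⊆ [y (n + 1), y n]` following the dynamics occupy a
proportion of `[y (n + 1), y n]` that is bounded away from zero. -/
theorem exists_distortion_bound {F : ℝ → ℝ} {p : ℝ} (hF : AnalyticAt ℝ F p)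
    (hpos : 0 < deriv F p) :
    ∃ δ > 0, ∀ y w : ℕ → ℝ, (∀ n, y n ∈ Ioo p (p + δ)) → (∀ n, y (n + 1) = F (y n)) →
      (∀ n, w (n + 1) = F (w n)) → (∀ n, y (n + 1) ≤ w n) → (∀ n, w n < y n) →
      ∃ ε > 0, ∀ n, ε * (y n - y (n + 1)) ≤ y n - w n := by
  obtain ⟨K, t, ht, hK⟩ := (hF.deriv.contDiffAt (n := 1)).exists_lipschitzOnWith
  set m := deriv F p / 2 with hm
  have hm0 : 0 < m := by positivity
  have hev : ∀ᶠ x in nhds p, x ∈ t ∧ AnalyticAt ℝ F x ∧ m < deriv F x := by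
    filter_upwards [ht, hF.eventually_analyticAt,
      hF.deriv.continuousAt.eventually (lt_mem_nhds (show m < deriv F p by linarith))]
      with x h1 h2 h3 using ⟨h1, h2, h3⟩
  obtain ⟨δ₀, hδ₀, hball⟩ := Metric.eventually_nhds_iff.1 hev
  set C : ℝ := K / m with hC
  have hC0 : 0 ≤ C := by positivity
  have hKC : (K : ℝ) = C * m := by rw [hC]; field_simp
  refine ⟨min δ₀ (1 / (2 * (C + 1))), by positivity, ?_⟩
  intro y w hy hyF hwF hyw hwy
  have good : ∀ x n, y (n + 1) ≤ x → x ≤ y n →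
      x ∈ t ∧ AnalyticAt ℝ F x ∧ m < deriv F x := by
    intro x n h1 h2
    apply hball
    rw [Real.dist_eq, abs_lt]
    have := (hy n).2
    have := (hy (n + 1)).1
    have := min_le_left δ₀ (1 / (2 * (C + 1)))
    constructor <;> linarith
  have hsmall : ∀ n, C * (y n - p) < 1 := by
    intro n
    have h1 : y n - p < 1 / (2 * (C + 1)) := by
      have := (hy n).2
      have := min_le_right δ₀ (1 / (2 * (C + 1)))
      linarith
    have h2 : 0 < y n - p := by linarith [(hy n).1]
    rw [lt_div_iff₀ (by positivity)] at h1
    nlinarith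
  have slope_eq : ∀ n a b, y (n + 1) ≤ a → a < b → b ≤ y n →
      ∃ ξ, ξ ∈ Icc (y (n + 1)) (y n) ∧ F b - F a = deriv F ξ * (b - a) := by
    intro n a b ha hab hb
    have hd : ∀ x ∈ Icc a b, DifferentiableAt ℝ F x := fun x hx =>
      (good x n (ha.trans hx.1) (hx.2.trans hb)).2.1.differentiableAt
    obtain ⟨ξ, hξ, h⟩ := exists_deriv_eq_slope F hab
      (fun x hx => (hd x hx).continuousAt.continuousWithinAt)
      (fun x hx => (hd x (Ioo_subset_Icc_self hx)).differentiableWithinAt)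
    refine ⟨ξ, ⟨ha.trans hξ.1.le, hξ.2.le.trans hb⟩, ?_⟩
    rw [h]
    field_simp [(sub_pos.2 hab).ne']
  have step : ∀ n, (1 - C * (y n - y (n + 1))) * (y n - w n) * (y (n + 1) - y (n + 2)) ≤
      (y (n + 1) - w (n + 1)) * (y n - y (n + 1)) := by
    intro n
    have hd : y (n + 1) < y n := (hyw n).trans_lt (hwy n)
    obtain ⟨ξ, hξ, h1⟩ := slope_eq n (w n) (y n) (hyw n) (hwy n) le_rfl
    obtain ⟨η, hη, h2⟩ := slope_eq n (y (n + 1)) (y n) le_rfl hd le_rfl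
    rw [← hyF, ← hwF] at h1
    rw [← hyF, ← hyF] at h2
    rw [h1, show y (n + 2) = y (n + 1 + 1) from rfl, h2]
    have hη' := (good η n hη.1 hη.2).2.2
    have hlip := hK.dist_le_mul ξ (good ξ n hξ.1 hξ.2).1 η (good η n hη.1 hη.2).1
    rw [Real.dist_eq, Real.dist_eq] at hlip
    have hdist : |ξ - η| ≤ y n - y (n + 1) := by
      rw [abs_le]
      constructor <;> linarith [hξ.1, hξ.2, hη.1, hη.2]
    have h3 : deriv F η - deriv F ξ ≤ C * (y n - y (n + 1)) * deriv F η := by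
      calc deriv F η - deriv F ξ ≤ |deriv F ξ - deriv F η| := by
            rw [abs_sub_comm]; exact le_abs_self _
        _ ≤ K * (y n - y (n + 1)) := hlip.trans (by gcongr)
        _ = C * (y n - y (n + 1)) * m := by rw [hKC]; ring
        _ ≤ _ := by
            have := mul_nonneg hC0 (sub_pos.2 hd).le
            gcongr
    have hpos' : 0 ≤ (y n - w n) * (y n - y (n + 1)) :=
      mul_nonneg (sub_pos.2 (hwy n)).le (sub_pos.2 hd).le
    nlinarith [mul_le_mul_of_nonneg_right h3 hpos']
  have hd : ∀ n, 0 < y n - y (n + 1) := fun n => sub_pos.2 ((hyw n).trans_lt (hwy n))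
  have he : ∀ n, 0 < y n - w n := fun n => sub_pos.2 (hwy n)
  have hs : ∀ n, 0 < 1 - C * (y n - p) := fun n => sub_pos.2 (hsmall n)
  set ε := (y 0 - w 0) * (1 - C * (y 0 - p)) / (y 0 - y 1) with hε
  have hε0 : 0 < ε := div_pos (mul_pos (he 0) (hs 0)) (hd 0)
  have key : ∀ n, ε * (y n - y (n + 1)) ≤ (y n - w n) * (1 - C * (y n - p)) := by
    intro n
    induction n with
    | zero => rw [hε, zero_add, div_mul_cancel₀ _ (hd 0).ne']
    | succ n ih =>
      refine le_of_mul_le_mul_right ?_ (hd n)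
      have h1 : ε * (y n - y (n + 1)) * (y (n + 1) - y (n + 2)) ≤
          (y n - w n) * (1 - C * (y n - p)) * (y (n + 1) - y (n + 2)) :=
        mul_le_mul_of_nonneg_right ih (hd (n + 1)).le
      have h2 := mul_le_mul_of_nonneg_right (step n) (hs (n + 1)).le
      have h3 : 0 ≤ C * (y n - y (n + 1)) * (C * (y (n + 1) - p)) *
          ((y n - w n) * (y (n + 1) - y (n + 2))) := by
        have := (he n).le
        have := (hd n).le
        have := (hd (n + 1)).le
        have := sub_nonneg.2 (hy (n + 1)).1.le
        positivity
      have : y (n + 1 + 1) = y (n + 2) := rfl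
      rw [this]
      nlinarith
  refine ⟨ε, hε0, fun n => (key n).trans ?_⟩
  have : 0 ≤ C * (y n - p) := mul_nonneg hC0 (sub_nonneg.2 (hy n).1.le)
  nlinarith [he n]

theorem mul_apply' (f g : HomeoI) (x : unitInterval) : (f * g) x = f (g x) := rfl

theorem one_apply' (x : unitInterval) : (1 : HomeoI) x = x := rfl

theorem inv_apply_apply (f : HomeoI) (x : unitInterval) : f⁻¹ (f x) = x :=
  f.symm_apply_apply x

theorem apply_inv_apply (f : HomeoI) (x : unitInterval) : f (f⁻¹ x) = x :=
  f.apply_symm_apply x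

theorem inv_fixed {f : HomeoI} {x : unitInterval} (h : f x = x) : f⁻¹ x = x := by
  conv_lhs => rw [← h]
  exact inv_apply_apply f x

theorem pow_succ_apply (f : HomeoI) (n : ℕ) (x : unitInterval) :
    (f ^ (n + 1)) x = f ((f ^ n) x) := by
  rw [pow_succ', mul_apply']

theorem pow_fixed {f : HomeoI} {x : unitInterval} (h : f x = x) (n : ℕ) : (f ^ n) x = x := by
  induction n with
  | zero => rw [pow_zero, one_apply']
  | succ n ih => rw [pow_succ_apply, ih, h]

/-- An analytic homeomorphism of `I` with fixed points accumulating somewhere is the identity. -/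
theorem eq_one_of_tendsto {f : HomeoI} (hf : IsAnalytic f) {u : ℕ → unitInterval}
    {p : unitInterval} (hu : Tendsto u atTop (𝓝 p)) (hne : ∀ n, u n ≠ p)
    (hfix : ∀ n, f (u n) = u n) : f = 1 := by
  obtain ⟨F, hF, hFf⟩ := hf
  have htend : Tendsto (fun n => (u n : ℝ)) atTop (𝓝[≠] (p : ℝ)) :=
    tendsto_nhdsWithin_iff.2 ⟨(continuous_subtype_val.tendsto p).comp hu,
      Eventually.of_forall fun n h => hne n (Subtype.ext h)⟩
  have hEq := AnalyticOnNhd.eqOn_of_preconnected_of_frequently_eq (f := F) (g := id)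
    (U := Icc (0 : ℝ) 1) (z₀ := p) hF (fun x _ => analyticAt_id) isPreconnected_Icc p.2
    (htend.frequently (Frequently.of_forall fun n => by
      rw [hFf, hfix]; rfl))
  ext x
  rw [← hFf, hEq x.2]
  rfl

/-- Forward orbits moving to the left converge to a fixed point. -/
theorem exists_tendsto_pow_of_lt {f : HomeoI} {x : unitInterval} (hx : f x < x) :
    ∃ q < x, f q = q ∧ (∀ n, q < (f ^ n) x) ∧ StrictAnti (fun n : ℕ => (f ^ n) x) ∧
      Tendsto (fun n : ℕ => (f ^ n) x) atTop (𝓝 q) := by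
  have hanti : StrictAnti (fun n : ℕ => (f ^ n) x) := by
    refine strictAnti_nat_of_succ_lt fun n => ?_
    rw [pow_succ, mul_apply']
    exact (f ^ n).strictMono hx
  have ht := tendsto_atTop_iInf hanti.antitone
  set q := ⨅ n : ℕ, (f ^ n) x
  have hq : ∀ n, q < (f ^ n) x := fun n =>
    (iInf_le _ (n + 1)).trans_lt (hanti n.lt_succ_self)
  refine ⟨q, hq 0, ?_, hq, hanti, ht⟩
  refine tendsto_nhds_unique ((f.continuous.tendsto q).comp ht) ?_
  refine (ht.comp (tendsto_add_atTop_nat 1)).congr fun n => ?_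
  simp only [Function.comp, pow_succ_apply]

/-- Forward orbits moving to the right converge to a fixed point. -/
theorem exists_tendsto_pow_of_gt {f : HomeoI} {x : unitInterval} (hx : x < f x) :
    ∃ q, (∀ n, (f ^ n) x < q) ∧
      Tendsto (fun n : ℕ => (f ^ n) x) atTop (𝓝 q) := by
  have hmono : StrictMono (fun n : ℕ => (f ^ n) x) := by
    refine strictMono_nat_of_lt_succ fun n => ?_
    rw [pow_succ, mul_apply']
    exact (f ^ n).strictMono hx
  exact ⟨_, fun n => (hmono n.lt_succ_self).trans_le (le_iSup (fun n => (f ^ n) x) (n + 1)),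
    tendsto_atTop_iSup hmono.monotone⟩

/-- A homeomorphism preserving the fixed point set of a nontrivial analytic one fixes that set
pointwise. -/
theorem fixed_of_preserves {h k : HomeoI} (hh : IsAnalytic h) (hne : h ≠ 1)
    (hk : ∀ x, h x = x → h (k x) = k x) {x : unitInterval} (hx : h x = x) : k x = x := by
  have hfix : ∀ n : ℕ, h ((k ^ n) x) = (k ^ n) x := by
    intro n
    induction n with
    | zero => simpa [one_apply'] using hx
    | succ n ih => rw [pow_succ_apply]; exact hk _ ih
  by_contra hkx
  apply hne
  rcases lt_or_gt_of_ne hkx with hlt | hgt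
  · obtain ⟨q, -, -, hq, -, ht⟩ := exists_tendsto_pow_of_lt hlt
    exact eq_one_of_tendsto hh ht (fun n => (hq n).ne') hfix
  · obtain ⟨q, hq, ht⟩ := exists_tendsto_pow_of_gt hgt
    exact eq_one_of_tendsto hh ht (fun n => (hq n).ne) hfix

/-- `f` has multiplier `μ` at its fixed point `p`, as seen from the right. -/
def HasMultiplier (f : HomeoI) (p : unitInterval) (μ : ℝ) : Prop :=
  f p = p ∧ Tendsto (fun x : unitInterval => ((f x : ℝ) - p) / (x - p)) (𝓝[>] p) (𝓝 μ)

theorem tendsto_coe_nhdsGT (p : unitInterval) :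
    Tendsto (fun x : unitInterval => (x : ℝ)) (𝓝[>] p) (𝓝[>] (p : ℝ)) :=
  tendsto_nhdsWithin_iff.2 ⟨(continuous_subtype_val.tendsto p).mono_left nhdsWithin_le_nhds,
    eventually_mem_nhdsWithin⟩

theorem tendsto_nhdsGT_of_fixed {f : HomeoI} {p : unitInterval} (hp : f p = p) :
    Tendsto f (𝓝[>] p) (𝓝[>] p) := by
  refine tendsto_nhdsWithin_iff.2 ⟨?_, ?_⟩
  · conv_rhs => rw [← hp]
    exact (f.continuous.tendsto p).mono_left nhdsWithin_le_nhds
  · filter_upwards [eventually_mem_nhdsWithin] with x hx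
    have := f.strictMono hx
    rwa [hp] at this

theorem hasMultiplier_deriv {f : HomeoI} {p : unitInterval} (hp : f p = p) {F : ℝ → ℝ}
    (hF : AnalyticAt ℝ F p) (hFf : ∀ x : unitInterval, F x = (f x : ℝ)) :
    HasMultiplier f p (deriv F p) := by
  refine ⟨hp, ?_⟩
  have h := (hasDerivAt_iff_tendsto_slope.1 hF.differentiableAt.hasDerivAt).comp
    ((tendsto_coe_nhdsGT p).mono_right (nhdsWithin_mono _ fun x hx => (ne_of_gt hx)))
  refine h.congr fun x => ?_
  simp only [Function.comp, slope_def_field, hFf, hp]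

theorem HasMultiplier.mul {f g : HomeoI} {p : unitInterval} {μ ν : ℝ}
    (hf : HasMultiplier f p μ) (hg : HasMultiplier g p ν) : HasMultiplier (f * g) p (μ * ν) := by
  refine ⟨by rw [mul_apply', hg.1, hf.1], ?_⟩
  have hgt := tendsto_nhdsGT_of_fixed hg.1
  refine ((hf.2.comp hgt).mul hg.2).congr' ?_
  filter_upwards [hgt.eventually eventually_mem_nhdsWithin] with x hx
  have : (0 : ℝ) < g x - p := sub_pos.2 hx
  simp only [Function.comp, mul_apply']
  field_simp

theorem HasMultiplier.unique {f : HomeoI} {p : unitInterval} [(𝓝[>] p).NeBot] {μ ν : ℝ}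
    (h : HasMultiplier f p μ) (h' : HasMultiplier f p ν) : μ = ν :=
  tendsto_nhds_unique h.2 h'.2

theorem HasMultiplier.nonneg {f : HomeoI} {p : unitInterval} [(𝓝[>] p).NeBot] {μ : ℝ}
    (h : HasMultiplier f p μ) : 0 ≤ μ := by
  refine ge_of_tendsto h.2 ?_
  filter_upwards [eventually_mem_nhdsWithin,
    (tendsto_nhdsGT_of_fixed h.1).eventually eventually_mem_nhdsWithin] with x hx hfx
  exact div_nonneg (sub_nonneg.2 (le_of_lt hfx)) (sub_nonneg.2 (le_of_lt hx))

theorem HasMultiplier.one (p : unitInterval) : HasMultiplier 1 p 1 := by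
  refine ⟨rfl, tendsto_const_nhds.congr' ?_⟩
  filter_upwards [eventually_mem_nhdsWithin] with x hx
  have : (0 : ℝ) < x - p := sub_pos.2 hx
  rw [one_apply', div_self this.ne']

theorem HasMultiplier.inv {f : HomeoI} {p : unitInterval} {μ : ℝ}
    (h : HasMultiplier f p μ) (hμ : μ ≠ 0) : HasMultiplier f⁻¹ p μ⁻¹ := by
  have hp := inv_fixed h.1
  refine ⟨hp, ((h.2.inv₀ hμ).comp (tendsto_nhdsGT_of_fixed hp)).congr fun x => ?_⟩
  simp only [Function.comp, apply_inv_apply, inv_div]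

theorem exists_hasMultiplier {f : HomeoI} (hf : IsAnalytic f) (hf' : IsAnalytic f⁻¹)
    {p : unitInterval} [(𝓝[>] p).NeBot] (hp : f p = p) :
    ∃ μ > 0, HasMultiplier f p μ := by
  obtain ⟨F, hF, hFf⟩ := hf
  obtain ⟨G, hG, hGf⟩ := hf'
  have h1 := hasMultiplier_deriv hp (hF p p.2) hFf
  have h2 := hasMultiplier_deriv (inv_fixed hp) (hG p p.2) hGf
  have h3 := h1.mul h2
  rw [mul_inv_cancel] at h3
  have h4 := h3.unique (HasMultiplier.one p)
  refine ⟨_, lt_of_le_of_ne h1.nonneg ?_, h1⟩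
  rintro h0
  rw [← h0, zero_mul] at h4
  exact zero_ne_one h4

theorem HasMultiplier.pow {f : HomeoI} {p : unitInterval} (h : HasMultiplier f p 1) (n : ℕ) :
    HasMultiplier (f ^ n) p 1 := by
  induction n with
  | zero => exact HasMultiplier.one p
  | succ n ih => simpa [pow_succ'] using h.mul ih

/-- The relative displacement towards `p`. -/
theorem HasMultiplier.tendsto_displacement {f : HomeoI} {p : unitInterval} {μ : ℝ}
    (h : HasMultiplier f p μ) :
    Tendsto (fun x : unitInterval => ((x : ℝ) - f x) / (x - p)) (𝓝[>] p) (𝓝 (1 - μ)) := by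
  refine (h.2.const_sub 1).congr' ?_
  filter_upwards [eventually_mem_nhdsWithin] with x hx
  have : (0 : ℝ) < x - p := sub_pos.2 hx
  field_simp
  ring

/-- A homeomorphism contracting hyperbolically towards `p` cannot have two further fixed points
`a < b` if some `k` tangent to the identity at `p` and contracting `[p, b]` to `p` has powers
commuting with their conjugates under `f`. -/
theorem false_of_multiplier_lt_one {f k : HomeoI} (hf : IsAnalytic f) {p a b : unitInterval}
    (hpa : p < a) (hab : a < b) (hfa : f a = a) (hfb : f b = b) {μ : ℝ} (hμ0 : 0 < μ)
    (hμ1 : μ < 1) (hfp : HasMultiplier f p μ) (hk : HasMultiplier k p 1)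
    (hlim : Tendsto (fun n : ℕ => (k ^ n) b) atTop (𝓝[>] p))
    (hcomm : ∀ j n : ℕ, Commute (k ^ j) ((f ^ n)⁻¹ * k ^ j * f ^ n)) : False := by
  have : (𝓝[>] p).NeBot := nhdsGT_neBot_of_exists_gt ⟨a, hpa⟩
  obtain ⟨F, hF, hFf⟩ := hf
  have hderiv : deriv F p = μ := (hasMultiplier_deriv hfp.1 (hF p p.2) hFf).unique hfp
  obtain ⟨δ, hδ, hdist⟩ := exists_distortion_bound (hF p p.2) (hderiv ▸ hμ0)
  have hev : ∀ᶠ x : unitInterval in 𝓝[>] p, f x < x ∧ (x : ℝ) < p + δ := by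
    have h1 := (tendsto_coe_nhdsGT p).mono_right nhdsWithin_le_nhds
    filter_upwards [hfp.2.eventually (gt_mem_nhds hμ1), eventually_mem_nhdsWithin,
      h1.eventually (gt_mem_nhds (show (p : ℝ) < p + δ by linarith))] with x hx hpx hxδ
    have hpx' : (0 : ℝ) < x - p := sub_pos.2 hpx
    rw [div_lt_one hpx'] at hx
    exact ⟨Subtype.coe_lt_coe.1 (by linarith), hxδ⟩
  obtain ⟨x₀, hx₀, hgood⟩ := (mem_nhdsGT_iff_exists_Ioo_subset' hpa).1 hev
  obtain ⟨j, ⟨hpj, hjx⟩, hja⟩ := ((hlim.eventually (Ioo_mem_nhdsGT hx₀)).and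
    (hlim.eventually (Ioo_mem_nhdsGT hpa))).exists
  set h := k ^ j with hh
  have hmult : HasMultiplier h p 1 := hk.pow j
  set y := h b with hy
  have hfy : f y < y := (hgood ⟨hpj, hjx⟩).1
  obtain ⟨q, hqy, hfq, hq, hanti, hqlim⟩ := exists_tendsto_pow_of_lt hfy
  have hpow : ∀ n, p < (f ^ n) y := fun n => by
    have := (f ^ n).strictMono hpj
    rwa [pow_fixed hfp.1] at this
  have hqp : q = p := by
    have hpq : p ≤ q := ge_of_tendsto' hqlim fun n => (hpow n).le
    refine (eq_or_lt_of_le hpq).elim Eq.symm fun hlt => ?_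
    exact absurd hfq (hgood ⟨hlt, hqy.trans hjx⟩).1.ne
  subst hqp
  have hylim : Tendsto (fun n : ℕ => (f ^ n) y) atTop (𝓝[>] q) :=
    tendsto_nhdsWithin_iff.2 ⟨hqlim, Eventually.of_forall hpow⟩
  set w := max (h a) (f y) with hw
  have hwy : w < y := max_lt (h.strictMono hab) hfy
  obtain ⟨ε, hε, hεn⟩ := hdist (fun n => (f ^ n) y) (fun n => (f ^ n) w)
    (fun n => ⟨hpow n, lt_of_le_of_lt (hanti.antitone n.zero_le) (hgood ⟨hpj, hjx⟩).2⟩)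
    (fun n => by rw [hFf, pow_succ_apply]) (fun n => by rw [hFf, pow_succ_apply])
    (fun n => by
      rw [pow_succ, mul_apply']
      exact (f ^ n).monotone (le_max_right _ _))
    (fun n => (f ^ n).strictMono hwy)
  have hbound : ∀ n : ℕ, h ((f ^ n) y) ≤ (f ^ n) w := by
    intro n
    have hc : h (((f ^ n)⁻¹ * h * f ^ n) b) = ((f ^ n)⁻¹ * h * f ^ n) (h b) :=
      DFunLike.congr_fun (hcomm j n).eq b
    simp only [mul_apply', pow_fixed hfb] at hc
    have hle : (f ^ n)⁻¹ (h b) ≤ a := by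
      have := (f ^ n)⁻¹.monotone hja.2.le
      rwa [inv_fixed (pow_fixed hfa n)] at this
    have := (f ^ n).monotone (hc ▸ h.monotone hle)
    rw [apply_inv_apply] at this
    exact this.trans ((f ^ n).monotone (le_max_left _ _))
  have hfinal : ε * (1 - μ) ≤ 1 - 1 := by
    refine le_of_tendsto_of_tendsto' ((hfp.tendsto_displacement.comp hylim).const_mul ε)
      (hmult.tendsto_displacement.comp hylim) fun n => ?_
    have h0 : (0 : ℝ) < (f ^ n) y - q := sub_pos.2 (hpow n)
    have h1 := hεn n
    have h2 : (h ((f ^ n) y) : ℝ) ≤ (f ^ n) w := hbound n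
    simp only [Function.comp, pow_succ_apply] at h1 ⊢
    rw [← mul_div_assoc]
    gcongr
    linarith
  nlinarith

/-- The displacement of a nontrivial analytic `k` is asymptotically invariant under maps tangent
to the identity. -/
theorem tendsto_displacement_ratio {k φ : HomeoI} (hk : IsAnalytic k) (hne : k ≠ 1)
    {p : unitInterval} (hφ : HasMultiplier φ p 1) :
    Tendsto (fun x : unitInterval => ((k (φ x) : ℝ) - φ x) / (k x - x)) (𝓝[>] p) (𝓝 1) ∧
      ∀ᶠ x in 𝓝[>] p, k x ≠ x := by
  obtain ⟨F, hF, hFk⟩ := hk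
  have hana : AnalyticAt ℝ (fun x => F x - x) p := (hF p p.2).sub analyticAt_id
  have hnot : ¬ ∀ᶠ z in 𝓝 (p : ℝ), F z - z = 0 := by
    intro hz
    apply hne
    have hEq := AnalyticOnNhd.eqOn_of_preconnected_of_eventuallyEq (f := F) (g := id)
      (U := Icc (0 : ℝ) 1) hF (fun x _ => analyticAt_id) isPreconnected_Icc p.2
      (hz.mono fun z hz => sub_eq_zero.1 hz)
    ext x
    rw [← hFk, hEq x.2]
    rfl
  obtain ⟨m, G, hG, hG0, hFG⟩ := hana.exists_eventuallyEq_pow_smul_nonzero_iff.2 hnot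
  have hcoe := (tendsto_coe_nhdsGT p).mono_right nhdsWithin_le_nhds
  have hev : ∀ᶠ x : unitInterval in 𝓝[>] p,
      ((k x : ℝ) - x = ((x : ℝ) - p) ^ m * G x) ∧ G x ≠ 0 := by
    filter_upwards [hcoe.eventually hFG,
      hcoe.eventually (hG.continuousAt.eventually_ne hG0)] with x h1 h2
    rw [hFk, smul_eq_mul] at h1
    exact ⟨h1, h2⟩
  have hφp := tendsto_nhdsGT_of_fixed hφ.1
  have hGlim : Tendsto (fun x : unitInterval => G x) (𝓝[>] p) (𝓝 (G p)) :=
    hG.continuousAt.tendsto.comp hcoe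
  refine ⟨?_, ?_⟩
  · have hlim := (hφ.2.pow m).mul ((hGlim.comp hφp).div hGlim hG0)
    rw [one_pow, one_mul, div_self hG0] at hlim
    refine hlim.congr' ?_
    filter_upwards [hev, hφp.eventually hev] with x hx hx'
    simp only [Function.comp, Pi.div_apply]
    rw [hx.1, hx'.1, div_pow, mul_div_mul_comm]
  · filter_upwards [hev, eventually_mem_nhdsWithin] with x hx hpx h
    have : (0 : ℝ) < x - p := sub_pos.2 hpx
    rw [h, sub_self] at hx
    exact mul_ne_zero (pow_ne_zero m this.ne') hx.2 hx.1.symm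

/-- Conjugating a nontrivial analytic `k` by a map tangent to the identity at `p` does not change
the displacement of `k` near `p` to leading order. -/
theorem tendsto_conj_displacement {f k : HomeoI} (hf : IsAnalytic f) (hk : IsAnalytic k)
    (hne : k ≠ 1) {p : unitInterval} [(𝓝[>] p).NeBot] (hfp : HasMultiplier f p 1)
    (hkp : k p = p) :
    Tendsto (fun x : unitInterval => (((f * k * f⁻¹) x : ℝ) - x) / (k x - x)) (𝓝[>] p)
      (𝓝 1) := by
  obtain ⟨F, hF, hFf⟩ := hf
  have hderiv : deriv F p = 1 := (hasMultiplier_deriv hfp.1 (hF p p.2) hFf).unique hfp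
  have hfinv : HasMultiplier f⁻¹ p 1 := by simpa using hfp.inv one_ne_zero
  obtain ⟨hratio, hmoves⟩ := tendsto_displacement_ratio hk hne hfinv
  have hcoe := (tendsto_coe_nhdsGT p).mono_right nhdsWithin_le_nhds
  have hstrict := (hF p p.2).hasStrictDerivAt.hasStrictFDerivAt.isLittleO
  have hlim : Tendsto (fun x : unitInterval => ((k x : ℝ), (x : ℝ))) (𝓝[>] p)
      (𝓝 ((p : ℝ), (p : ℝ))) :=
    (hcoe.comp (tendsto_nhdsGT_of_fixed hkp)).prodMk_nhds hcoe
  have hT := ((hstrict.comp_tendsto hlim).tendsto_div_nhds_zero).add_const 1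
  rw [zero_add] at hT
  have hT' : Tendsto (fun x : unitInterval => ((f (k x) : ℝ) - f x) / (k x - x)) (𝓝[>] p)
      (𝓝 1) := by
    refine hT.congr' ?_
    filter_upwards [hmoves] with x hx
    have : (k x : ℝ) - x ≠ 0 := sub_ne_zero.2 fun h => hx (Subtype.ext h)
    simp only [Function.comp, hFf, hderiv, ContinuousLinearMap.toSpanSingleton_apply, smul_eq_mul,
      mul_one]
    field_simp
    ring
  have hinv := tendsto_nhdsGT_of_fixed hfinv.1
  have hprod := (hT'.comp hinv).mul hratio
  rw [one_mul] at hprod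
  refine hprod.congr' ?_
  filter_upwards [hinv.eventually hmoves] with x hx
  have : (k (f⁻¹ x) : ℝ) - f⁻¹ x ≠ 0 := sub_ne_zero.2 fun h => hx (Subtype.ext h)
  simp only [Function.comp, mul_apply', apply_inv_apply]
  field_simp

/-- Let `f` and `k` be tangent to the identity at `p`, with `k` contracting towards `p`. If `k`
commutes with its conjugate under `f`, then that conjugate does not contract faster than `k`. -/
theorem false_of_conj_lt {f k : HomeoI} (hf : IsAnalytic f) (hk : IsAnalytic k)
    {p b : unitInterval} (hpb : p < b) (hfp : HasMultiplier f p 1) (hkp : HasMultiplier k p 1)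
    (hkb : k b < b) (hlim : Tendsto (fun n : ℕ => (k ^ n) b) atTop (𝓝[>] p))
    (hlt : (f * k * f⁻¹) b < k b) (hcomm : Commute (f * k * f⁻¹) k) : False := by
  have : (𝓝[>] p).NeBot := nhdsGT_neBot_of_exists_gt ⟨b, hpb⟩
  have hne : k ≠ 1 := by
    rintro rfl
    exact lt_irrefl b hkb
  have hconj := tendsto_conj_displacement hf hk hne hfp hkp.1
  obtain ⟨hself, hmoves⟩ := tendsto_displacement_ratio hk hne hkp
  obtain ⟨K, hK, hKk⟩ := hk
  have hderiv : deriv K p = 1 := (hasMultiplier_deriv hkp.1 (hK p p.2) hKk).unique hkp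
  obtain ⟨δ, hδ, hdist⟩ := exists_distortion_bound (hK p p.2) (hderiv ▸ one_pos)
  have hcoe := (tendsto_coe_nhdsGT p).mono_right nhdsWithin_le_nhds
  set g := f * k * f⁻¹ with hg
  have hanti : StrictAnti (fun n : ℕ => (k ^ n) b) := by
    obtain ⟨-, -, -, -, h, -⟩ := exists_tendsto_pow_of_lt hkb
    exact h
  have hpow : ∀ n, p < (k ^ n) b := fun n => by
    have := (k ^ n).strictMono hpb
    rwa [pow_fixed hkp.1] at this
  obtain ⟨j, hj⟩ := ((hcoe.comp hlim).eventually
    (gt_mem_nhds (show (p : ℝ) < p + δ by linarith))).exists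
  set c := (k ^ j) b with hc
  have hpc : ∀ n, (k ^ n) c = (k ^ (n + j)) b := fun n => by rw [hc, ← mul_apply', pow_add]
  have hclim : Tendsto (fun n : ℕ => (k ^ n) c) atTop (𝓝[>] p) :=
    (hlim.comp (tendsto_add_atTop_nat j)).congr fun n => (hpc n).symm
  have hantic : ∀ n, k ((k ^ n) c) < (k ^ n) c := fun n => by
    rw [← pow_succ_apply, hpc, hpc]
    exact hanti (by omega)
  have hlt' : g c < k c := by
    have h1 : g c = (k ^ j) (g b) := DFunLike.congr_fun (hcomm.pow_right j).eq b
    have h2 : k c = (k ^ j) (k b) :=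
      DFunLike.congr_fun ((Commute.refl k).pow_right j).eq b
    rw [h1, h2]
    exact (k ^ j).strictMono hlt
  set w := max (g c) (k (k c)) with hw
  have hwy : w < k c := max_lt hlt' (k.strictMono (hantic 0))
  have hsucc : ∀ n, (k ^ n) (k c) = k ((k ^ n) c) := fun n => by
    rw [← mul_apply', ← pow_succ, pow_succ_apply]
  obtain ⟨ε, hε, hεn⟩ := hdist (fun n => (k ^ n) (k c)) (fun n => (k ^ n) w)
    (fun n => by
      have h0 : (k ^ n) (k c) = (k ^ (n + 1 + j)) b := by
        rw [hsucc, ← pow_succ_apply, hpc]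
      simp only [h0]
      refine ⟨hpow _, lt_of_le_of_lt ?_ hj⟩
      exact hanti.antitone (show j ≤ n + 1 + j by omega))
    (fun n => by rw [hKk, pow_succ_apply]) (fun n => by rw [hKk, pow_succ_apply])
    (fun n => by
      rw [pow_succ, mul_apply']
      exact (k ^ n).monotone (le_max_right _ _))
    (fun n => (k ^ n).strictMono hwy)
  have hfinal : ε * 1 ≤ 1 - 1 := by
    refine le_of_tendsto_of_tendsto ((hself.comp hclim).const_mul ε)
      ((hconj.comp hclim).sub_const 1) ?_
    filter_upwards [hclim.eventually hmoves] with n hn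
    have h0 : (0 : ℝ) < (k ^ n) c - k ((k ^ n) c) := sub_pos.2 (hantic n)
    have h1 := hεn n
    have h2 : (g ((k ^ n) c) : ℝ) ≤ (k ^ n) w := by
      have : g ((k ^ n) c) = (k ^ n) (g c) := DFunLike.congr_fun (hcomm.pow_right n).eq c
      rw [this]
      exact (k ^ n).monotone (le_max_left _ _)
    simp only [Function.comp, pow_succ_apply, hsucc] at h1 ⊢
    have h0' : (k ((k ^ n) c) : ℝ) - (k ^ n) c ≠ 0 := by linarith
    rw [← mul_div_assoc, div_sub_one h0', ← neg_div_neg_eq, ← neg_div_neg_eq (_ - _ - _)]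
    rw [neg_sub _ ((k ^ n) c : ℝ)]
    gcongr
    linarith
  linarith

/-- A nontrivial solvable subgroup normalizes a nontrivial abelian subgroup of itself. -/
theorem exists_abelian_normalized {G : Type*} [Group G] (Γ : Subgroup G)
    (hsol : Group.IsSolvable ↥Γ) (hΓ : Γ ≠ ⊥) :
    ∃ N ≤ Γ, N ≠ ⊥ ∧ (∀ h ∈ N, ∀ k ∈ N, Commute h k) ∧ ∀ f ∈ Γ, ∀ h ∈ N, f * h * f⁻¹ ∈ N := by
  classical
  have hex : ∃ n, derivedSeries ↥Γ n = ⊥ := hsol.solvable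
  obtain ⟨n, hn⟩ : ∃ n, Nat.find hex = n + 1 := by
    refine Nat.exists_eq_succ_of_ne_zero fun h0 => hΓ ?_
    have h := Nat.find_spec hex
    rw [h0, derivedSeries_zero] at h
    rw [eq_bot_iff]
    intro x hx
    have : (⟨x, hx⟩ : ↥Γ) ∈ (⊥ : Subgroup ↥Γ) := h ▸ Subgroup.mem_top _
    exact congrArg Subtype.val (Subgroup.mem_bot.1 this)
  have hbot := Nat.find_spec hex
  have hnebot := Nat.find_min hex (show n < Nat.find hex by omega)
  rw [hn, derivedSeries_succ] at hbot
  refine ⟨(derivedSeries ↥Γ n).map Γ.subtype, Subgroup.map_subtype_le _, ?_, ?_, ?_⟩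
  · rwa [Ne, Subgroup.map_eq_bot_iff_of_injective _ Γ.subtype_injective]
  · rintro _ ⟨h, hh, rfl⟩ _ ⟨k, hk, rfl⟩
    have := Subgroup.commutator_mem_commutator hh hk
    rw [hbot, Subgroup.mem_bot, commutatorElement_eq_one_iff_commute] at this
    exact this.map Γ.subtype
  · rintro f hf _ ⟨h, hh, rfl⟩
    exact ⟨⟨f, hf⟩ * h * ⟨f, hf⟩⁻¹, (derivedSeries_normal ↥Γ n).conj_mem h hh ⟨f, hf⟩, rfl⟩

/-- The largest fixed point below `a`. -/
theorem sSup_fixed_points {h : HomeoI} (a : unitInterval) :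
    h (sSup {x | h x = x ∧ x ≤ a}) = sSup {x | h x = x ∧ x ≤ a} := by
  have hclosed : IsClosed {x : unitInterval | h x = x ∧ x ≤ a} :=
    (isClosed_eq h.continuous continuous_id).inter isClosed_Iic
  have hne : {x : unitInterval | h x = x ∧ x ≤ a}.Nonempty := ⟨⊥, h.map_bot, bot_le⟩
  exact (hclosed.sSup_mem hne).1

theorem inv_lt_of_lt {k : HomeoI} {x : unitInterval} (h : x < k x) : k⁻¹ x < x := by
  have := k⁻¹.strictMono h
  rwa [inv_apply_apply] at this

/-- In a solvable group of analytic homeomorphisms, a nontrivial element cannot have two fixed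
points `a < b` such that another element moves every point of `[a, b]`. -/
theorem false_of_fixed_of_moves {Γ : Subgroup HomeoI} (hω : ∀ f ∈ Γ, IsAnalytic f)
    (hsol : Group.IsSolvable ↥Γ) {f g : HomeoI} (hf : f ∈ Γ) (hg : g ∈ Γ) (hf1 : f ≠ 1)
    {a b : unitInterval} (hab : a < b) (hfa : f a = a) (hfb : f b = b)
    (hgab : ∀ z, a ≤ z → z ≤ b → g z ≠ z) : False := by
  have hΓ : Γ ≠ ⊥ := fun h => hf1 (Subgroup.mem_bot.1 (h ▸ hf))
  obtain ⟨N, hNΓ, hN, hcomm, hconj⟩ := exists_abelian_normalized Γ hsol hΓ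
  have hfixN : ∀ h ∈ N, h ≠ 1 → ∀ k ∈ N, ∀ x, h x = x → k x = x := fun h hh h1 k hk x hx =>
    fixed_of_preserves (hω h (hNΓ hh)) h1 (fun z hz => by
      rw [← mul_apply', (hcomm h hh k hk).eq, mul_apply', hz]) hx
  have hfixΓ : ∀ h ∈ N, h ≠ 1 → ∀ k ∈ Γ, ∀ x, h x = x → k x = x := fun h hh h1 k hk x hx =>
    fixed_of_preserves (hω h (hNΓ hh)) h1 (fun z hz => by
      have hz' := hfixN h hh h1 _ (hconj k⁻¹ (Γ.inv_mem hk) h hh) z hz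
      rw [inv_inv, mul_apply', mul_apply'] at hz'
      rw [← apply_inv_apply k (h (k z)), hz']) hx
  have hmove : ∀ h ∈ N, h ≠ 1 → ∀ z, a ≤ z → z ≤ b → h z ≠ z := fun h hh h1 z haz hzb hz =>
    hgab z haz hzb (hfixΓ h hh h1 g hg z hz)
  have hnoncomm : ∀ h ∈ N, h ≠ 1 → f * h * f⁻¹ ≠ h := by
    intro h hh h1 he
    refine hmove h hh h1 a le_rfl hab.le
      (fixed_of_preserves (hω f hf) hf1 (fun z hz => ?_) hfa)
    have hz' : (f * h * f⁻¹) z = h z := by rw [he]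
    rwa [mul_apply', mul_apply', inv_fixed hz] at hz'
  obtain ⟨h₀, hh₀, hne₀⟩ := N.bot_or_exists_ne_one.resolve_left hN
  set p := sSup {x | h₀ x = x ∧ x ≤ a} with hp
  have hp₀ : h₀ p = p := sSup_fixed_points a
  have hpa : p < a := by
    refine lt_of_le_of_ne (sSup_le fun x hx => hx.2) fun he => ?_
    exact hmove h₀ hh₀ hne₀ a le_rfl hab.le (he ▸ hp₀)
  have hpb := hpa.trans hab
  have hpΓ : ∀ k ∈ Γ, k p = p := fun k hk => hfixΓ h₀ hh₀ hne₀ k hk p hp₀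
  have hmove' : ∀ h ∈ N, h ≠ 1 → ∀ z, p < z → z ≤ b → h z ≠ z := by
    intro h hh h1 z hpz hzb hz
    rcases le_or_gt a z with haz | hza
    · exact hmove h hh h1 z haz hzb hz
    · exact hpz.not_ge (le_sSup ⟨hfixN h hh h1 h₀ hh₀ z hz, hza.le⟩)
  have : (𝓝[>] p).NeBot := nhdsGT_neBot_of_exists_gt ⟨a, hpa⟩
  have hmult : ∀ k ∈ Γ, ∃ μ > 0, HasMultiplier k p μ := fun k hk =>
    exists_hasMultiplier (hω k hk) (hω _ (Γ.inv_mem hk)) (hpΓ k hk)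
  obtain ⟨μ, hμ, hfμ⟩ := hmult f hf
  obtain ⟨ν, hν, hhν⟩ := hmult h₀ (hNΓ hh₀)
  obtain ⟨k, hkN, hk1, hkp, hkb⟩ : ∃ k ∈ N, k ≠ 1 ∧ HasMultiplier k p 1 ∧ k b < b := by
    have hcN : f * h₀ * f⁻¹ * h₀⁻¹ ∈ N := N.mul_mem (hconj f hf h₀ hh₀) (N.inv_mem hh₀)
    have hc1 : f * h₀ * f⁻¹ * h₀⁻¹ ≠ 1 := fun he =>
      hnoncomm h₀ hh₀ hne₀ (mul_inv_eq_one.1 he)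
    have hcp : HasMultiplier (f * h₀ * f⁻¹ * h₀⁻¹) p 1 := by
      have := ((hfμ.mul hhν).mul (hfμ.inv hμ.ne')).mul (hhν.inv hν.ne')
      rwa [show μ * ν * μ⁻¹ * ν⁻¹ = 1 by field_simp] at this
    rcases lt_or_gt_of_ne (hmove _ hcN hc1 b hab.le le_rfl) with hlt | hgt
    · exact ⟨_, hcN, hc1, hcp, hlt⟩
    · exact ⟨_, N.inv_mem hcN, inv_ne_one.2 hc1, by simpa using hcp.inv one_ne_zero,
        inv_lt_of_lt hgt⟩
  have hlim : Tendsto (fun n : ℕ => (k ^ n) b) atTop (𝓝[>] p) := by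
    have hpow : ∀ n, p < (k ^ n) b := fun n => by
      have := (k ^ n).strictMono hpb
      rwa [pow_fixed hkp.1] at this
    obtain ⟨q, hqb, hkq, hq, -, hqlim⟩ := exists_tendsto_pow_of_lt hkb
    have hpq : p ≤ q := ge_of_tendsto' hqlim fun n => (hpow n).le
    have hqp : p = q := hpq.eq_or_lt.resolve_right fun hlt => hmove' k hkN hk1 q hlt hqb.le hkq
    exact tendsto_nhdsWithin_iff.2 ⟨hqp ▸ hqlim, Eventually.of_forall hpow⟩
  have hyp : ∀ f' ∈ Γ, f' a = a → f' b = b → ∀ μ' > 0, HasMultiplier f' p μ' → 1 ≤ μ' := by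
    intro f' hf' hfa' hfb' μ' hμ' hfp'
    by_contra! hlt
    refine false_of_multiplier_lt_one (hω f' hf') hpa hab hfa' hfb' hμ' hlt hfp' hkp hlim
      fun j n => hcomm _ (N.pow_mem hkN j) _ ?_
    simpa using hconj (f' ^ n)⁻¹ (Γ.inv_mem (Γ.pow_mem hf' n)) _ (N.pow_mem hkN j)
  have hμ1 : μ = 1 := by
    refine le_antisymm ?_ (hyp f hf hfa hfb μ hμ hfμ)
    have := hyp f⁻¹ (Γ.inv_mem hf) (inv_fixed hfa) (inv_fixed hfb) μ⁻¹ (inv_pos.2 hμ)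
      (hfμ.inv hμ.ne')
    exact (one_le_inv₀ hμ).1 this
  subst hμ1
  have hfinv : HasMultiplier f⁻¹ p 1 := by simpa using hfμ.inv one_ne_zero
  have hne : f (k b) ≠ k b := by
    intro he
    refine hmove (k⁻¹ * (f * k * f⁻¹)) (N.mul_mem (N.inv_mem hkN) (hconj f hf k hkN))
      (fun h => hnoncomm k hkN hk1 (inv_mul_eq_one.1 h).symm) b hab.le le_rfl ?_
    rw [mul_apply', mul_apply', mul_apply', inv_fixed hfb, he, inv_apply_apply]
  rcases lt_or_gt_of_ne hne with hlt | hgt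
  · refine false_of_conj_lt (hω f hf) (hω k (hNΓ hkN)) hpb hfμ hkp hkb hlim ?_
      (hcomm _ (hconj f hf k hkN) k hkN)
    rwa [mul_apply', mul_apply', inv_fixed hfb]
  · refine false_of_conj_lt (hω _ (Γ.inv_mem hf)) (hω k (hNΓ hkN)) hpb hfinv hkp hkb hlim ?_
      (hcomm _ (hconj f⁻¹ (Γ.inv_mem hf) k hkN) k hkN)
    rw [inv_inv, mul_apply', mul_apply', hfb]
    exact inv_lt_of_lt hgt

theorem zpow_fixed {g : HomeoI} {z : unitInterval} (hz : g z = z) (n : ℤ) : (g ^ n) z = z := by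
  obtain ⟨m, rfl | rfl⟩ := n.eq_nat_or_neg
  · rw [zpow_natCast, pow_fixed hz]
  · rw [zpow_neg, zpow_natCast, inv_fixed (pow_fixed hz m)]

/-- An element has no fixed points in its orbitals. -/
theorem IsOrbitalOf.apply_ne {g : HomeoI} {A : Set unitInterval} (hA : IsOrbitalOf g A)
    {z : unitInterval} (hz : z ∈ A) : g z ≠ z := by
  obtain ⟨x, rfl, hnt⟩ := hA
  intro hgz
  obtain ⟨_, ⟨n, rfl⟩, _, ⟨m, rfl⟩, h1, h2⟩ := hz
  have hxz : x = z := by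
    refine le_antisymm ((g ^ n).le_iff_le.1 ?_) ((g ^ m).le_iff_le.1 ?_)
    · rwa [zpow_fixed hgz]
    · rwa [zpow_fixed hgz]
  subst hxz
  obtain ⟨u, ⟨_, ⟨i, rfl⟩, _, ⟨j, rfl⟩, h3, h4⟩, v, ⟨_, ⟨i', rfl⟩, _, ⟨j', rfl⟩, h5, h6⟩, huv⟩ :=
    hnt
  simp only [zpow_fixed hgz] at h3 h4 h5 h6
  exact huv ((le_antisymm h4 h3).trans (le_antisymm h5 h6))

theorem IsOrbitalOf.ordConnected {g : HomeoI} {A : Set unitInterval} (hA : IsOrbitalOf g A) :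
    A.OrdConnected := by
  obtain ⟨x, rfl, -⟩ := hA
  refine ⟨?_⟩
  rintro u ⟨c, hc, -, -, hcu, -⟩ v ⟨-, -, d, hd, -, hvd⟩ z hz
  exact ⟨c, hc, d, hd, hcu.trans hz.1, hz.2.trans hvd⟩

theorem IsOrbitalOf.image_eq {g : HomeoI} {A : Set unitInterval} (hA : IsOrbitalOf g A) :
    g '' A = A := by
  obtain ⟨x, rfl, -⟩ := hA
  have hsucc : ∀ n : ℤ, (g ^ (1 + n)) x = g ((g ^ n) x) := fun n => by
    rw [zpow_add, zpow_one, mul_apply']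
  ext z
  constructor
  · rintro ⟨u, ⟨_, ⟨n, rfl⟩, _, ⟨m, rfl⟩, h1, h2⟩, rfl⟩
    exact ⟨_, ⟨1 + n, rfl⟩, _, ⟨1 + m, rfl⟩, (hsucc n).trans_le (g.monotone h1),
      (g.monotone h2).trans_eq (hsucc m).symm⟩
  · rintro ⟨_, ⟨n, rfl⟩, _, ⟨m, rfl⟩, h1, h2⟩
    refine ⟨g⁻¹ z, ⟨_, ⟨-1 + n, rfl⟩, _, ⟨-1 + m, rfl⟩, ?_, ?_⟩, apply_inv_apply g z⟩
    · simp only [zpow_add, zpow_neg_one, mul_apply']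
      exact g⁻¹.monotone h1
    · simp only [zpow_add, zpow_neg_one, mul_apply']
      exact g⁻¹.monotone h2

theorem IsOrbitalOf.sInf_fixed {g : HomeoI} {A : Set unitInterval} (hA : IsOrbitalOf g A) :
    g (sInf A) = sInf A := by
  rw [g.map_sInf, ← sInf_image, hA.image_eq]

theorem IsOrbitalOf.sSup_fixed {g : HomeoI} {A : Set unitInterval} (hA : IsOrbitalOf g A) :
    g (sSup A) = sSup A := by
  rw [g.map_sSup, ← sSup_image, hA.image_eq]

theorem leftEnd_eq {A : Set unitInterval} (hA : A.Nonempty) :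
    leftEnd A = (sInf A : unitInterval) := by
  refine IsGLB.csInf_eq ⟨?_, fun c hc => ?_⟩ (hA.image _)
  · rintro _ ⟨x, hx, rfl⟩
    exact Subtype.coe_le_coe.2 (sInf_le hx)
  · rcases le_or_gt c 0 with h | h
    · exact h.trans (sInf A).2.1
    · obtain ⟨x, hx⟩ := hA
      have hc1 : c ≤ 1 := (hc (mem_image_of_mem _ hx)).trans x.2.2
      exact Subtype.coe_le_coe.2 (le_sInf (a := (⟨c, h.le, hc1⟩ : unitInterval))
        fun y hy => hc (mem_image_of_mem _ hy))

theorem rightEnd_eq {A : Set unitInterval} (hA : A.Nonempty) :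
    rightEnd A = (sSup A : unitInterval) := by
  refine IsLUB.csSup_eq ⟨?_, fun c hc => ?_⟩ (hA.image _)
  · rintro _ ⟨x, hx, rfl⟩
    exact Subtype.coe_le_coe.2 (le_sSup hx)
  · rcases le_or_gt 1 c with h | h
    · exact (sSup A).2.2.trans h
    · obtain ⟨x, hx⟩ := hA
      have hc0 : 0 ≤ c := x.2.1.trans (hc (mem_image_of_mem _ hx))
      exact Subtype.coe_le_coe.2 (sSup_le (a := (⟨c, hc0, h.le⟩ : unitInterval))
        fun y hy => hc (mem_image_of_mem _ hy))

/-- In a solvable group of analytic homeomorphisms, nested orbitals share an end. -/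
theorem shareEnd_of_subset {Γ : Subgroup HomeoI} (hω : ∀ f ∈ Γ, IsAnalytic f)
    (hsol : Group.IsSolvable ↥Γ) {f g : HomeoI} (hf : f ∈ Γ) (hg : g ∈ Γ)
    {A B : Set unitInterval} (hA : IsOrbitalOf f A) (hB : IsOrbitalOf g B) (hAB : A ⊆ B) :
    ShareEnd A B := by
  have hnt : A.Nontrivial := hA.choose_spec.2
  by_contra hshare
  rw [ShareEnd, leftEnd_eq hnt.nonempty, rightEnd_eq hnt.nonempty,
    leftEnd_eq (hnt.nonempty.mono hAB), rightEnd_eq (hnt.nonempty.mono hAB), not_or] at hshare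
  have hl : sInf B < sInf A := lt_of_le_of_ne (sInf_le_sInf hAB) fun h =>
    hshare.1 (by rw [h])
  have hr : sSup A < sSup B := lt_of_le_of_ne (sSup_le_sSup hAB) fun h =>
    hshare.2 (by rw [h])
  obtain ⟨u, hu, v, hv, huv⟩ := hnt.exists_lt
  have hab : sInf A < sSup A := (sInf_le hu).trans_lt (huv.trans_le (le_sSup hv))
  have hf1 : f ≠ 1 := by
    rintro rfl
    exact hA.apply_ne hu rfl
  refine false_of_fixed_of_moves hω hsol hf hg hf1 hab hA.sInf_fixed hA.sSup_fixed
    fun z haz hzb => hB.apply_ne ?_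
  obtain ⟨c, hc, hcz⟩ := sInf_lt_iff.1 (hl.trans_le haz)
  obtain ⟨d, hd, hzd⟩ := lt_sSup_iff.1 (hzb.trans_lt hr)
  exact hB.ordConnected.out hc hd ⟨hcz.le, hzd.le⟩

/-- A solvable subgroup of `Diff^ω₊(I)` does not possess a strict tower of cardinality
two (equivalently, its strict height is `1`). -/
theorem solvable_analytic_no_strict_tower_of_two (Γ : Subgroup HomeoI)
    (hω : ∀ f ∈ Γ, IsAnalytic f) (hsol : IsSolvable ↥Γ) :
    ¬ ∃ T, IsStrictTower Γ T ∧ (towerOrbitals T).encard = 2 := by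
  rintro ⟨T, ⟨⟨horb, hchain, -⟩, hstrict⟩, hcard⟩
  obtain ⟨A, B, hne, hT⟩ := Set.encard_eq_two.1 hcard
  obtain ⟨p, hp, rfl⟩ : A ∈ towerOrbitals T := hT ▸ mem_insert A {B}
  obtain ⟨q, hq, rfl⟩ : B ∈ towerOrbitals T := hT ▸ mem_insert_of_mem _ rfl
  rcases hchain p hp q hq with h | h
  · exact hstrict p hp q hq hne
      (shareEnd_of_subset hω hsol (horb p hp).1 (horb q hq).1 (horb p hp).2 (horb q hq).2 h)
  · exact hstrict q hq p hp hne.symm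
      (shareEnd_of_subset hω hsol (horb q hq).1 (horb p hp).1 (horb q hq).2 (horb p hp).2 h)

end HeightHomeo
end

section
/- Let φ: ℝ → (0,1) be an increasing homeomorphism, and let Γ ≤ Homeo₊(I) be the subgroup generated by the homeomorphisms of [0,1] obtained by extending φ∘f∘φ⁻¹ and φ∘g∘φ⁻¹ by the identity at 0 and 1, where f(x) = 2x and g(x) = x+1 on ℝ. Then Γ is isomorphic to the Baumslag–Solitar group BS(1,2), every nonidentity element of Γ has at most one fixed point in (0,1) (so h_strict(Γ) = 1), and h(Γ) = ∞ (for every natural number n the element corresponding to x ↦ 2ⁿx + 1 has an orbital corresponding to (−∞, −1/(2ⁿ−1)), and these orbitals form an infinite tower). -/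
open Set

namespace HeightHomeo

/-- The inclusion of the open unit interval `(0,1)` into `I = [0,1]`. -/
def emb (p : Set.Ioo (0 : ℝ) 1) : unitInterval :=
  ⟨p.1, Set.Ioo_subset_Icc_self p.2⟩

/-- The defining relator of the Baumslag–Solitar group `BS(1,2) = ⟨a, b ∣ a b a⁻¹ = b²⟩`. -/
def bsRels : Set (FreeGroup (Fin 2)) :=
  {FreeGroup.of 0 * FreeGroup.of 1 * (FreeGroup.of 0)⁻¹ *
    (FreeGroup.of 1)⁻¹ * (FreeGroup.of 1)⁻¹}

/-- The Baumslag–Solitar group `BS(1,2)`. -/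
abbrev BS12 := PresentedGroup bsRels

lemma mul_apply {α : Type*} [Preorder α] (f g : α ≃o α) (x : α) : (f * g) x = f (g x) := rfl

lemma one_apply {α : Type*} [Preorder α] (x : α) : (1 : α ≃o α) x = x := rfl

lemma inv_apply_eq {α : Type*} [Preorder α] {f : α ≃o α} {x y : α} (h : f x = y) :
    f⁻¹ y = x := by
  subst h
  exact f.symm_apply_apply x

/-- Elements of a quotient of `BS(1,2)` have the form `a⁻ⁱ bᵐ aʲ`. -/
lemma exists_normal_form {H : Type*} [Group H] {a b : H} (hab : a * b * a⁻¹ = b ^ 2)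
    {h : H} (hh : h ∈ Subgroup.closure {a, b}) :
    ∃ (i j : ℕ) (m : ℤ), h = (a ^ i)⁻¹ * b ^ m * a ^ j := by
  have conj_zpow_one : ∀ m : ℤ, a * b ^ m = b ^ (2 * m) * a := by
    intro m
    rw [← mul_inv_eq_iff_eq_mul, ← conj_zpow, hab, ← zpow_natCast, ← zpow_mul]
    rfl
  have conj_pow_zpow : ∀ (i : ℕ) (m : ℤ), a ^ i * b ^ m = b ^ (2 ^ i * m) * a ^ i := by
    intro i
    induction i with
    | zero => intro m; simp
    | succ i ih =>
      intro m
      rw [pow_succ, mul_assoc, conj_zpow_one, ← mul_assoc, ih, mul_assoc, pow_succ, mul_assoc]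
  have zpow_mul_normal_form : ∀ (k : ℤ) (i j : ℕ) (m : ℤ),
      b ^ k * ((a ^ i)⁻¹ * b ^ m * a ^ j) = (a ^ i)⁻¹ * b ^ (2 ^ i * k + m) * a ^ j := by
    intro k i j m
    rw [zpow_add, eq_comm]
    simp only [mul_assoc]
    rw [inv_mul_eq_iff_eq_mul, ← mul_assoc (a ^ i), conj_pow_zpow]
    simp only [mul_assoc, mul_inv_cancel_left]
  induction hh using Subgroup.closure_induction_left with
  | one => exact ⟨0, 0, 0, by simp⟩
  | mul_left x hx y _ ih =>
    obtain ⟨i, j, m, rfl⟩ := ih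
    rcases hx with rfl | rfl
    · cases i with
      | zero =>
        refine ⟨0, j + 1, 2 * m, ?_⟩
        simp only [pow_zero, inv_one, one_mul]
        rw [← mul_assoc, conj_zpow_one, mul_assoc, pow_succ']
      | succ i =>
        refine ⟨i, j, m, ?_⟩
        rw [pow_succ, mul_inv_rev]
        simp only [mul_assoc, mul_inv_cancel_left]
    · exact ⟨i, j, _, by rw [← zpow_mul_normal_form 1 i j m, zpow_one]⟩
  | inv_mul_cancel x hx y _ ih =>
    obtain ⟨i, j, m, rfl⟩ := ih
    rcases hx with rfl | rfl
    · refine ⟨i + 1, j, m, ?_⟩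
      rw [pow_succ, mul_inv_rev]
      simp only [mul_assoc]
    · exact ⟨i, j, _, by rw [← zpow_mul_normal_form (-1) i j m, zpow_neg_one]⟩

section Interior

variable (φ : ℝ ≃o Set.Ioo (0 : ℝ) 1)

lemma emb_le_emb_iff {x y : ℝ} : emb (φ x) ≤ emb (φ y) ↔ x ≤ y :=
  φ.le_iff_le

lemma emb_injective : Function.Injective fun x : ℝ => emb (φ x) := fun _ _ h =>
  le_antisymm ((emb_le_emb_iff φ).1 h.le) ((emb_le_emb_iff φ).1 h.ge)

lemma exists_emb_eq {y : unitInterval} (h0 : 0 < (y : ℝ)) (h1 : (y : ℝ) < 1) :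
    ∃ x : ℝ, emb (φ x) = y :=
  ⟨φ.symm ⟨y, h0, h1⟩, by rw [φ.apply_symm_apply]; rfl⟩

lemma homeo_ext {h k : HomeoI} (H : ∀ x : ℝ, h (emb (φ x)) = k (emb (φ x))) : h = k := by
  refine OrderIso.ext (funext fun y => ?_)
  rcases (unitInterval.nonneg y).eq_or_lt with h0 | h0
  · have : y = ⊥ := Subtype.ext h0.symm
    rw [this, h.map_bot, k.map_bot]
  rcases (unitInterval.le_one y).eq_or_lt with h1 | h1
  · have : y = ⊤ := Subtype.ext h1
    rw [this, h.map_top, k.map_top]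
  obtain ⟨x, rfl⟩ := exists_emb_eq φ h0 h1
  exact H x

lemma zpow_apply_of_homothety {h : HomeoI} {c l : ℝ} (hl : l ≠ 0)
    (H : ∀ t : ℝ, h (emb (φ (c + t))) = emb (φ (c + l * t))) (k : ℤ) (t : ℝ) :
    (h ^ k) (emb (φ (c + t))) = emb (φ (c + l ^ k * t)) := by
  have H' : ∀ t : ℝ, h⁻¹ (emb (φ (c + t))) = emb (φ (c + l⁻¹ * t)) := fun t =>
    inv_apply_eq (by rw [H, mul_inv_cancel_left₀ hl])
  induction k using Int.induction_on generalizing t with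
  | zero => simp [one_apply]
  | succ k ih => rw [zpow_add_one, mul_apply, H, ih, zpow_add_one₀ hl, mul_assoc]
  | pred k ih => rw [zpow_sub_one, mul_apply, H', ih, zpow_sub_one₀ hl, mul_assoc]

lemma zpow_apply_of_translation {h : HomeoI}
    (H : ∀ t : ℝ, h (emb (φ t)) = emb (φ (t + 1))) (k : ℤ) (t : ℝ) :
    (h ^ k) (emb (φ t)) = emb (φ (t + k)) := by
  have H' : ∀ t : ℝ, h⁻¹ (emb (φ t)) = emb (φ (t - 1)) := fun t =>
    inv_apply_eq (by rw [H, sub_add_cancel])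
  induction k using Int.induction_on generalizing t with
  | zero => simp [one_apply]
  | succ k ih => rw [zpow_add_one, mul_apply, H, ih]; push_cast; ring_nf
  | pred k ih => rw [zpow_sub_one, mul_apply, H', ih]; push_cast; ring_nf

lemma isOrbitalOf_of_homothety {h : HomeoI} {c l : ℝ} (hl : 1 < l)
    (H : ∀ t : ℝ, h (emb (φ (c + t))) = emb (φ (c + l * t))) :
    IsOrbitalOf h ((fun x : ℝ => emb (φ x)) '' Set.Iio c) := by
  have l_pos : 0 < l := one_pos.trans hl
  have zpow_eq := zpow_apply_of_homothety φ l_pos.ne' H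
  refine ⟨emb (φ (c + -1)), ?_, ?_⟩
  · ext y
    constructor
    · rintro ⟨x, hx : x < c, rfl⟩
      obtain ⟨k, hk₁, hk₂⟩ := exists_mem_Ico_zpow (sub_pos.2 hx) hl
      refine ⟨_, ⟨k + 1, rfl⟩, _, ⟨k, rfl⟩, ?_, ?_⟩
      · simp only [zpow_eq, emb_le_emb_iff]
        linarith
      · simp only [zpow_eq, emb_le_emb_iff]
        linarith
    · rintro ⟨_, ⟨k, rfl⟩, _, ⟨m, rfl⟩, hk, hm⟩
      simp only [zpow_eq] at hk hm
      obtain ⟨x, rfl⟩ := exists_emb_eq φ (y := y)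
        ((φ (c + l ^ k * -1)).2.1.trans_le hk) (lt_of_le_of_lt hm (φ (c + l ^ m * -1)).2.2)
      refine ⟨x, ?_, rfl⟩
      rw [emb_le_emb_iff] at hm
      have := zpow_pos l_pos m
      exact Set.mem_Iio.2 (by linarith)
  · exact (Set.nontrivial_of_mem_mem_ne (x := c - 1) (y := c - 2)
      (by simp) (by simp) (by norm_num)).image (emb_injective φ)

end Interior

section Orbitals

lemma apply_zpow_apply (g : HomeoI) (n : ℤ) (x : unitInterval) :
    g ((g ^ n) x) = (g ^ (n + 1)) x := by
  rw [add_comm, zpow_one_add, mul_apply]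

lemma image_ordHull_orbit (g : HomeoI) (x : unitInterval) :
    g '' ordHull (Set.range fun n : ℤ => (g ^ n) x) =
      ordHull (Set.range fun n : ℤ => (g ^ n) x) := by
  ext y
  constructor
  · rintro ⟨z, ⟨_, ⟨n, rfl⟩, _, ⟨m, rfl⟩, hn, hm⟩, rfl⟩
    refine ⟨_, ⟨n + 1, rfl⟩, _, ⟨m + 1, rfl⟩, ?_, ?_⟩
    · simpa only [apply_zpow_apply] using g.monotone hn
    · simpa only [apply_zpow_apply] using g.monotone hm
  · rintro ⟨_, ⟨n, rfl⟩, _, ⟨m, rfl⟩, hn, hm⟩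
    refine ⟨g.symm y, ⟨_, ⟨n - 1, rfl⟩, _, ⟨m - 1, rfl⟩, ?_, ?_⟩, g.apply_symm_apply y⟩
    · rw [g.le_symm_apply, apply_zpow_apply, sub_add_cancel]
      exact hn
    · rw [g.symm_apply_le, apply_zpow_apply, sub_add_cancel]
      exact hm

lemma bddBelow_coe_image (A : Set unitInterval) :
    BddBelow ((fun x : unitInterval => (x : ℝ)) '' A) :=
  ⟨0, by rintro _ ⟨x, _, rfl⟩; exact x.2.1⟩

lemma bddAbove_coe_image (A : Set unitInterval) :
    BddAbove ((fun x : unitInterval => (x : ℝ)) '' A) :=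
  ⟨1, by rintro _ ⟨x, _, rfl⟩; exact x.2.2⟩

lemma leftEnd_nonneg (A : Set unitInterval) : 0 ≤ leftEnd A :=
  Real.sInf_nonneg (by rintro _ ⟨x, _, rfl⟩; exact x.2.1)

lemma rightEnd_le_one (A : Set unitInterval) : rightEnd A ≤ 1 :=
  Real.sSup_le (by rintro _ ⟨x, _, rfl⟩; exact x.2.2) zero_le_one

lemma leftEnd_le {A : Set unitInterval} {x : unitInterval} (hx : x ∈ A) : leftEnd A ≤ x :=
  csInf_le (bddBelow_coe_image A) ⟨x, hx, rfl⟩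

lemma le_rightEnd {A : Set unitInterval} {x : unitInterval} (hx : x ∈ A) : x ≤ rightEnd A :=
  le_csSup (bddAbove_coe_image A) ⟨x, hx, rfl⟩

lemma leftEnd_lt_rightEnd {A : Set unitInterval} (hA : A.Nontrivial) :
    leftEnd A < rightEnd A := by
  obtain ⟨x, hx, y, hy, hxy⟩ := hA.exists_lt
  exact (leftEnd_le hx).trans_lt ((Subtype.coe_lt_coe.2 hxy).trans_le (le_rightEnd hy))

lemma isGLB_leftEnd {A : Set unitInterval} (hA : A.Nonempty) {s : unitInterval}
    (hs : (s : ℝ) = leftEnd A) : IsGLB A s :=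
  ⟨fun x hx => Subtype.coe_le_coe.1 (hs ▸ leftEnd_le hx), fun y hy =>
    Subtype.coe_le_coe.1 (hs ▸ le_csInf (hA.image _)
      (by rintro _ ⟨x, hx, rfl⟩; exact hy hx))⟩

lemma isLUB_rightEnd {A : Set unitInterval} (hA : A.Nonempty) {s : unitInterval}
    (hs : (s : ℝ) = rightEnd A) : IsLUB A s :=
  ⟨fun x hx => Subtype.coe_le_coe.1 (hs ▸ le_rightEnd hx), fun y hy =>
    Subtype.coe_le_coe.1 (hs ▸ csSup_le (hA.image _)
      (by rintro _ ⟨x, hx, rfl⟩; exact hy hx))⟩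

lemma leftEnd_eq_zero_or_rightEnd_eq_one {g : HomeoI} {A : Set unitInterval}
    (hA : IsOrbitalOf g A)
    (hg : {x : unitInterval | 0 < (x : ℝ) ∧ (x : ℝ) < 1 ∧ g x = x}.Subsingleton) :
    leftEnd A = 0 ∨ rightEnd A = 1 := by
  obtain ⟨x, hx, nontriv⟩ := hA
  have image_eq : g '' A = A := by rw [hx]; exact image_ordHull_orbit g x
  have lt := leftEnd_lt_rightEnd nontriv
  by_contra! hne
  have l_pos := (leftEnd_nonneg A).lt_of_ne' hne.1
  have r_lt := (rightEnd_le_one A).lt_of_ne hne.2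
  let l : unitInterval := ⟨leftEnd A, l_pos.le, (lt.trans r_lt).le⟩
  let r : unitInterval := ⟨rightEnd A, (l_pos.trans lt).le, r_lt.le⟩
  have hl : IsGLB A l := isGLB_leftEnd nontriv.nonempty rfl
  have hr : IsLUB A r := isLUB_rightEnd nontriv.nonempty rfl
  have g_l : g l = l := IsGLB.unique (by simpa only [image_eq] using g.isGLB_image'.2 hl) hl
  have g_r : g r = r := IsLUB.unique (by simpa only [image_eq] using g.isLUB_image'.2 hr) hr
  have := hg (x := l) ⟨l_pos, lt.trans r_lt, g_l⟩ (y := r) ⟨l_pos.trans lt, r_lt, g_r⟩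
  exact lt.ne (congrArg Subtype.val this)

lemma shareEnd_of_subset_s5 {A B : Set unitInterval} (hA : A.Nonempty) (hAB : A ⊆ B)
    (h : leftEnd A = 0 ∨ rightEnd A = 1) : ShareEnd A B := by
  refine h.imp (fun h => ?_) fun h => ?_
  · exact le_antisymm (h ▸ leftEnd_nonneg B)
      (csInf_le_csInf (bddBelow_coe_image B) (hA.image _) (Set.image_mono hAB))
  · exact le_antisymm (csSup_le_csSup (bddAbove_coe_image B) (hA.image _) (Set.image_mono hAB))
      (h ▸ rightEnd_le_one B)

lemma IsOrbitalOf.ne_one {g : HomeoI} {A : Set unitInterval} (hA : IsOrbitalOf g A) :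
    g ≠ 1 := by
  rintro rfl
  obtain ⟨x, rfl, _, ⟨_, ⟨n, rfl⟩, _, ⟨m, rfl⟩, h₁, h₂⟩, _, ⟨_, ⟨n', rfl⟩, _, ⟨m', rfl⟩, h₃, h₄⟩,
    hne⟩ := hA
  simp only [one_zpow, one_apply] at h₁ h₂ h₃ h₄
  exact hne ((h₂.antisymm h₁).trans (h₄.antisymm h₃).symm)

lemma IsTower.encard_towerOrbitals {Γ : Subgroup HomeoI} {T : Set (Set unitInterval × HomeoI)}
    (hT : IsTower Γ T) : (towerOrbitals T).encard = T.encard :=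
  Set.InjOn.encard_image fun p hp q hq h => hT.2.2 p hp q hq h

lemma strictHeight_eq_one {Γ : Subgroup HomeoI} {g : HomeoI} {A : Set unitInterval} (hgΓ : g ∈ Γ)
    (hA : IsOrbitalOf g A)
    (hΓ : ∀ h ∈ Γ, h ≠ 1 →
      {x : unitInterval | 0 < (x : ℝ) ∧ (x : ℝ) < 1 ∧ h x = x}.Subsingleton) :
    strictHeight Γ = 1 := by
  refine le_antisymm (iSup₂_le fun T hT => ?_) ?_
  · have shareEnd : ∀ p ∈ T, ∀ q ∈ T, p.1 ⊆ q.1 → ShareEnd p.1 q.1 := by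
      intro p hp q _ hpq
      obtain ⟨mem, orbital⟩ := hT.1.1 p hp
      obtain ⟨x, _, nontriv⟩ := id orbital
      exact shareEnd_of_subset_s5 nontriv.nonempty hpq
        (leftEnd_eq_zero_or_rightEnd_eq_one orbital (hΓ _ mem orbital.ne_one))
    rw [Set.encard_le_one_iff]
    rintro _ _ ⟨p, hp, rfl⟩ ⟨q, hq, rfl⟩
    by_contra hne
    rcases hT.1.2.1 p hp q hq with hpq | hqp
    · exact hT.2 p hp q hq hne (shareEnd p hp q hq hpq)
    · exact hT.2 q hq p hp (Ne.symm hne) (shareEnd q hq p hp hqp)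
  · have tower : IsStrictTower Γ {(A, g)} := by
      refine ⟨⟨?_, ?_, ?_⟩, ?_⟩
      · rintro _ rfl
        exact ⟨hgΓ, hA⟩
      · rintro _ rfl _ rfl
        exact Or.inl subset_rfl
      · rintro _ rfl _ rfl _
        rfl
      · rintro _ rfl _ rfl h
        exact (h rfl).elim
    refine le_trans ?_ (le_iSup₂ (f := fun T (_ : T ∈ {T | IsStrictTower Γ T}) =>
      (towerOrbitals T).encard) _ tower)
    rw [tower.1.encard_towerOrbitals, Set.encard_singleton]

lemma height_eq_top {Γ : Subgroup HomeoI} {T : Set (Set unitInterval × HomeoI)}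
    (hT : IsTower Γ T) (hinf : T.Infinite) : height Γ = ⊤ := by
  refine top_le_iff.1 (le_trans ?_ (le_iSup₂ (f := fun T (_ : T ∈ {T | IsTower Γ T}) =>
      (towerOrbitals T).encard) T hT))
  rw [hT.encard_towerOrbitals, hinf.encard_eq]

end Orbitals

lemma pow_apply_of_doubling {φ : ℝ ≃o Set.Ioo (0 : ℝ) 1} {F : HomeoI}
    (hF : ∀ x : ℝ, F (emb (φ x)) = emb (φ (2 * x))) (i : ℕ) (x : ℝ) :
    (F ^ i) (emb (φ x)) = emb (φ (2 ^ i * x)) := by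
  simpa using zpow_apply_of_homothety φ (h := F) (c := 0) two_ne_zero
    (fun t => by simpa using hF t) i x

lemma conj_eq_sq {φ : ℝ ≃o Set.Ioo (0 : ℝ) 1} {F G : HomeoI}
    (hF : ∀ x : ℝ, F (emb (φ x)) = emb (φ (2 * x)))
    (hG : ∀ x : ℝ, G (emb (φ x)) = emb (φ (x + 1))) : F * G * F⁻¹ = G ^ 2 := by
  rw [mul_inv_eq_iff_eq_mul]
  refine homeo_ext φ fun x => ?_
  simp only [pow_two, mul_apply, hF, hG]
  ring_nf

lemma eq_and_eq_zero_of_fixed {φ : ℝ ≃o Set.Ioo (0 : ℝ) 1} {F G : HomeoI}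
    (hF : ∀ x : ℝ, F (emb (φ x)) = emb (φ (2 * x)))
    (hG : ∀ x : ℝ, G (emb (φ x)) = emb (φ (x + 1))) {i j : ℕ} {m : ℤ} {x y : ℝ} (hxy : x ≠ y)
    (hx : ((F ^ i)⁻¹ * G ^ m * F ^ j) (emb (φ x)) = emb (φ x))
    (hy : ((F ^ i)⁻¹ * G ^ m * F ^ j) (emb (φ y)) = emb (φ y)) : i = j ∧ m = 0 := by
  have affine : ∀ t : ℝ, ((F ^ i)⁻¹ * G ^ m * F ^ j) (emb (φ t)) = emb (φ t) →
      (2 : ℝ) ^ j * t + m = 2 ^ i * t := by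
    intro t ht
    have := congrArg (F ^ i) ht
    rw [← mul_apply, mul_assoc, mul_inv_cancel_left, mul_apply, pow_apply_of_doubling hF,
      pow_apply_of_doubling hF, zpow_apply_of_translation φ hG] at this
    exact emb_injective φ this
  have hx' := affine x hx
  have hy' := affine y hy
  have pow_eq : (2 : ℝ) ^ i = 2 ^ j :=
    mul_right_cancel₀ (sub_ne_zero.2 hxy) (by linear_combination hy' - hx')
  refine ⟨pow_right_injective₀ two_pos (by norm_num) pow_eq, ?_⟩
  rw [pow_eq] at hx'
  exact_mod_cast add_eq_left.1 hx'

lemma subsingleton_fixed {φ : ℝ ≃o Set.Ioo (0 : ℝ) 1} {F G : HomeoI}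
    (hF : ∀ x : ℝ, F (emb (φ x)) = emb (φ (2 * x)))
    (hG : ∀ x : ℝ, G (emb (φ x)) = emb (φ (x + 1))) {h : HomeoI}
    (hh : h ∈ Subgroup.closure {F, G}) (hne : h ≠ 1) :
    {x : unitInterval | 0 < (x : ℝ) ∧ (x : ℝ) < 1 ∧ h x = x}.Subsingleton := by
  obtain ⟨i, j, m, rfl⟩ := exists_normal_form (conj_eq_sq hF hG) hh
  rintro x ⟨hx0, hx1, hx⟩ y ⟨hy0, hy1, hy⟩
  obtain ⟨x, rfl⟩ := exists_emb_eq φ hx0 hx1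
  obtain ⟨y, rfl⟩ := exists_emb_eq φ hy0 hy1
  by_contra hxy
  obtain ⟨rfl, rfl⟩ := eq_and_eq_zero_of_fixed hF hG (fun h => hxy (by rw [h])) hx hy
  exact hne (by simp)

lemma nonempty_closure_mulEquiv {φ : ℝ ≃o Set.Ioo (0 : ℝ) 1} {F G : HomeoI}
    (hF : ∀ x : ℝ, F (emb (φ x)) = emb (φ (2 * x)))
    (hG : ∀ x : ℝ, G (emb (φ x)) = emb (φ (x + 1))) :
    Nonempty (↥(Subgroup.closure {F, G} : Subgroup HomeoI) ≃* BS12) := by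
  have rels : ∀ r ∈ bsRels, FreeGroup.lift ![F, G] r = 1 := by
    rintro _ rfl
    simp only [map_mul, map_inv, FreeGroup.lift_apply_of, Matrix.cons_val_zero,
      Matrix.cons_val_one]
    rw [conj_eq_sq hF hG, pow_two, mul_inv_cancel_right, mul_inv_cancel]
  let a : BS12 := PresentedGroup.of 0
  let b : BS12 := PresentedGroup.of 1
  let ψ : BS12 →* HomeoI := PresentedGroup.toGroup rels
  have ψ_a : ψ a = F := PresentedGroup.toGroup.of rels
  have ψ_b : ψ b = G := PresentedGroup.toGroup.of rels
  have range_of : Set.range (PresentedGroup.of : Fin 2 → BS12) = {a, b} := by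
    ext x
    simp [Fin.exists_fin_two, a, b, eq_comm]
  have closure_eq_top : Subgroup.closure {a, b} = ⊤ := by
    rw [← range_of, PresentedGroup.closure_range_of]
  have relation : a * b * a⁻¹ = b ^ 2 := by
    have : a * b * a⁻¹ * b⁻¹ * b⁻¹ = 1 :=
      PresentedGroup.one_of_mem (rels := bsRels) (Set.mem_singleton _)
    rw [mul_inv_eq_one, mul_inv_eq_iff_eq_mul] at this
    rw [this, pow_two]
  have injective : Function.Injective ψ := by
    rw [injective_iff_map_eq_one]
    intro w hw
    obtain ⟨i, j, m, rfl⟩ := exists_normal_form relation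
      (h := w) (closure_eq_top ▸ Subgroup.mem_top w)
    simp only [map_mul, map_inv, map_pow, map_zpow, ψ_a, ψ_b] at hw
    obtain ⟨rfl, rfl⟩ := eq_and_eq_zero_of_fixed hF hG (zero_ne_one (α := ℝ))
      (by rw [hw, one_apply]) (by rw [hw, one_apply])
    simp
  have range_eq : ψ.range = Subgroup.closure {F, G} := by
    rw [MonoidHom.range_eq_map, ← closure_eq_top, MonoidHom.map_closure, Set.image_pair, ψ_a, ψ_b]
  exact ⟨((MonoidHom.ofInjective injective).trans (MulEquiv.subgroupCongr range_eq)).symm⟩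

lemma mul_pow_mem_closure (F G : HomeoI) (n : ℕ) :
    G * F ^ n ∈ (Subgroup.closure {F, G} : Subgroup HomeoI) :=
  mul_mem (Subgroup.subset_closure (by simp))
    (pow_mem (Subgroup.subset_closure (by simp)) n)

lemma isOrbitalOf_mul_pow {φ : ℝ ≃o Set.Ioo (0 : ℝ) 1} {F G : HomeoI}
    (hF : ∀ x : ℝ, F (emb (φ x)) = emb (φ (2 * x)))
    (hG : ∀ x : ℝ, G (emb (φ x)) = emb (φ (x + 1))) {n : ℕ} (hn : 1 ≤ n) :
    IsOrbitalOf (G * F ^ n)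
      ((fun x : ℝ => emb (φ x)) '' Set.Iio (-(1 / ((2 : ℝ) ^ n - 1)))) := by
  have one_lt : (1 : ℝ) < 2 ^ n := one_lt_pow₀ one_lt_two (by lia)
  refine isOrbitalOf_of_homothety φ one_lt fun t => ?_
  rw [mul_apply, pow_apply_of_doubling hF, hG]
  have : (2 : ℝ) ^ n - 1 ≠ 0 := (sub_pos.2 one_lt).ne'
  congr 2
  field_simp
  ring

lemma eq_of_image_Iio_eq (φ : ℝ ≃o Set.Ioo (0 : ℝ) 1) {m n : ℕ}
    (h : (fun x : ℝ => emb (φ x)) '' Set.Iio (-(1 / ((2 : ℝ) ^ m - 1))) =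
      (fun x : ℝ => emb (φ x)) '' Set.Iio (-(1 / ((2 : ℝ) ^ n - 1)))) : m = n := by
  have := Set.Iio_injective ((emb_injective φ).image_injective h)
  rw [neg_inj, one_div, one_div, inv_inj, sub_left_inj] at this
  exact pow_right_injective₀ two_pos (by norm_num) this

/-- Let `φ : ℝ → (0,1)` be an increasing homeomorphism and let `Γ ≤ Homeo₊(I)` be
generated by the extensions (by the identity at `0` and `1`) of the conjugates by `φ`
of `x ↦ 2x` and `x ↦ x + 1`.  Then `Γ ≅ BS(1,2)`, every nonidentity element of `Γ`
has at most one fixed point in `(0,1)` (so `h_strict(Γ) = 1`), and `h(Γ) = ∞`: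
for every `n ≥ 1` the element corresponding to `x ↦ 2ⁿ x + 1` has an orbital
corresponding to `(-∞, -1/(2ⁿ - 1))`, and these orbitals form an infinite tower. -/
theorem baumslagSolitar_example (φ : ℝ ≃o Set.Ioo (0 : ℝ) 1) (F G : HomeoI)
    (hF : ∀ x : ℝ, F (emb (φ x)) = emb (φ (2 * x)))
    (hG : ∀ x : ℝ, G (emb (φ x)) = emb (φ (x + 1)))
    (hF0 : F 0 = 0) (hF1 : F 1 = 1) (hG0 : G 0 = 0) (hG1 : G 1 = 1) :
    Nonempty (↥(Subgroup.closure {F, G} : Subgroup HomeoI) ≃* BS12) ∧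
    (∀ h ∈ (Subgroup.closure {F, G} : Subgroup HomeoI), h ≠ 1 →
      {x : unitInterval | 0 < (x : ℝ) ∧ (x : ℝ) < 1 ∧ h x = x}.Subsingleton) ∧
    strictHeight (Subgroup.closure {F, G}) = 1 ∧
    height (Subgroup.closure {F, G}) = ⊤ ∧
    (∀ n : ℕ, 1 ≤ n → IsOrbitalOf (G * F ^ n)
      ((fun x : ℝ => emb (φ x)) '' Set.Iio (-(1 / ((2 : ℝ) ^ n - 1))))) ∧
    IsTower (Subgroup.closure {F, G})
      {p | ∃ n : ℕ, 1 ≤ n ∧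
        p = (((fun x : ℝ => emb (φ x)) '' Set.Iio (-(1 / ((2 : ℝ) ^ n - 1)))),
          G * F ^ n)} ∧
    {p | ∃ n : ℕ, 1 ≤ n ∧
        p = (((fun x : ℝ => emb (φ x)) '' Set.Iio (-(1 / ((2 : ℝ) ^ n - 1)))),
          G * F ^ n)}.Infinite := by
  have fixed : ∀ h ∈ (Subgroup.closure {F, G} : Subgroup HomeoI), h ≠ 1 →
      {x : unitInterval | 0 < (x : ℝ) ∧ (x : ℝ) < 1 ∧ h x = x}.Subsingleton :=
    fun _ hh hne => subsingleton_fixed hF hG hh hne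
  have tower : IsTower (Subgroup.closure {F, G})
      {p | ∃ n : ℕ, 1 ≤ n ∧
        p = (((fun x : ℝ => emb (φ x)) '' Set.Iio (-(1 / ((2 : ℝ) ^ n - 1)))),
          G * F ^ n)} := by
    refine ⟨?_, ?_, ?_⟩
    · rintro _ ⟨n, hn, rfl⟩
      exact ⟨mul_pow_mem_closure F G n, isOrbitalOf_mul_pow hF hG hn⟩
    · rintro _ ⟨m, _, rfl⟩ _ ⟨n, _, rfl⟩
      exact (le_total _ _).imp (fun h => Set.image_mono (Set.Iio_subset_Iio h))
        fun h => Set.image_mono (Set.Iio_subset_Iio h)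
    · rintro _ ⟨m, _, rfl⟩ _ ⟨n, _, rfl⟩ h
      rw [eq_of_image_Iio_eq φ h]
  have infinite : {p | ∃ n : ℕ, 1 ≤ n ∧
        p = (((fun x : ℝ => emb (φ x)) '' Set.Iio (-(1 / ((2 : ℝ) ^ n - 1)))),
          G * F ^ n)}.Infinite := by
    refine Set.infinite_of_injective_forall_mem (α := ℕ) (fun m n h => ?_)
      (fun n => ⟨n + 1, Nat.le_add_left 1 n, rfl⟩)
    exact Nat.succ_injective (eq_of_image_Iio_eq φ (congrArg Prod.fst h))
  exact ⟨nonempty_closure_mulEquiv hF hG, fixed,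
    strictHeight_eq_one (mul_pow_mem_closure F G 1) (isOrbitalOf_mul_pow hF hG le_rfl) fixed,
    height_eq_top tower infinite, fun _ hn => isOrbitalOf_mul_pow hF hG hn, tower, infinite⟩

end HeightHomeo
end
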